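/- arXiv:1703.01837 — 3 statements merged into one kernel-verified Lean document; each statement's English description precedes it below -/
import Mathlib

section
/- Let Q = (3 − √5)/2. Then Li₂(Q) = Σ_{n≥1} Q^n/n² = π²/15 − (log((1 + √5)/2))². -/
open Real

/-- The real dilogarithm series. -/
noncomputable def dilog (x : ℝ) : ℝ := ∑' n : ℕ, x ^ (n + 1) / ((n : ℝ) + 1) ^ 2

theorem hasSum_inv_succ_sq : HasSum (fun n : ℕ => 1 / ((n : ℝ) + 1) ^ 2) (π ^ 2 / 6) := by
  have h := (hasSum_nat_add_iff' 1).mpr hasSum_zeta_two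
  simpa using h

theorem norm_dilog_term_le (n : ℕ) {x : ℝ} (hx : x ∈ Set.Icc (-1 : ℝ) 1) :
    ‖x ^ (n + 1) / ((n : ℝ) + 1) ^ 2‖ ≤ 1 / ((n : ℝ) + 1) ^ 2 := by
  rw [norm_div, norm_pow, Real.norm_of_nonneg (by positivity : (0 : ℝ) ≤ ((n : ℝ) + 1) ^ 2)]
  gcongr
  exact pow_le_one₀ (norm_nonneg x) (abs_le.mpr hx)

theorem summable_dilog {x : ℝ} (hx : x ∈ Set.Icc (-1 : ℝ) 1) :
    Summable fun n : ℕ => x ^ (n + 1) / ((n : ℝ) + 1) ^ 2 :=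
  .of_norm_bounded hasSum_inv_succ_sq.summable fun n => norm_dilog_term_le n hx

theorem continuousOn_dilog : ContinuousOn dilog (Set.Icc (-1) 1) :=
  continuousOn_tsum (fun n => by fun_prop) hasSum_inv_succ_sq.summable
    fun n _ hx => norm_dilog_term_le n hx

theorem dilog_zero : dilog 0 = 0 := by simp [dilog]

theorem dilog_one : dilog 1 = π ^ 2 / 6 := by
  simpa [dilog] using hasSum_inv_succ_sq.tsum_eq

theorem hasDerivAt_dilog {x : ℝ} (hx : |x| < 1) (h0 : x ≠ 0) :
    HasDerivAt dilog (-log (1 - x) / x) x := by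
  obtain ⟨r, hxr, hr⟩ := exists_between hx
  have hr0 : 0 < r := (abs_nonneg x).trans_lt hxr
  have key := hasDerivAt_tsum_of_isPreconnected (𝕜 := ℝ)
    (g := fun (n : ℕ) (y : ℝ) => y ^ (n + 1) / ((n : ℝ) + 1) ^ 2)
    (g' := fun (n : ℕ) (y : ℝ) => y ^ n / ((n : ℝ) + 1)) (u := fun n : ℕ => r ^ n)
    (t := Set.Ioo (-r) r) (y₀ := 0) (y := x)
    (summable_geometric_of_lt_one hr0.le hr) isOpen_Ioo isPreconnected_Ioo
    (fun n y _ => by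
      convert! (hasDerivAt_pow (n + 1) y).div_const (((n : ℝ) + 1) ^ 2) using 1
      have : (n : ℝ) + 1 ≠ 0 := by positivity
      push_cast
      field_simp)
    (fun n y hy => by
      rw [norm_div, norm_pow, Real.norm_of_nonneg (by positivity : (0 : ℝ) ≤ (n : ℝ) + 1)]
      have h1 : ‖y‖ ^ n ≤ r ^ n := by
        gcongr
        exact (abs_lt.mpr hy).le
      exact (div_le_self (by positivity) (by linarith [n.cast_nonneg (α := ℝ)])).trans h1)
    ⟨by linarith, hr0⟩ (by simp) (abs_lt.mp hxr)
  convert! key using 1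
  rw [← (hasSum_pow_div_log_of_abs_lt_one hx).tsum_eq, ← tsum_div_const]
  refine tsum_congr fun n => ?_
  have : (n : ℝ) + 1 ≠ 0 := by positivity
  field_simp
  ring

theorem dilog_add_dilog_neg {x : ℝ} (hx : x ∈ Set.Icc (-1 : ℝ) 1) :
    dilog x + dilog (-x) = dilog (x ^ 2) / 2 := by
  have hx' : -x ∈ Set.Icc (-1 : ℝ) 1 := ⟨by linarith [hx.2], by linarith [hx.1]⟩
  have hinj : Function.Injective fun n : ℕ => 2 * n + 1 := fun a b h => by simpa using h
  rw [dilog, dilog, dilog, ← (summable_dilog hx).tsum_add (summable_dilog hx'), ← tsum_div_const,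
    ← hinj.tsum_eq]
  · refine tsum_congr fun n => ?_
    have : (n : ℝ) + 1 ≠ 0 := by positivity
    have h2 : 2 * n + 1 + 1 = 2 * (n + 1) := by ring
    have h3 : ((2 * n + 1 : ℕ) : ℝ) + 1 = 2 * ((n : ℝ) + 1) := by push_cast; ring
    simp only [h2, h3, pow_mul, neg_sq]
    field_simp
    ring
  · intro n hn
    rcases Nat.even_or_odd' n with ⟨k, rfl | rfl⟩
    · refine absurd ?_ hn
      have : Odd (2 * k + 1) := ⟨k, rfl⟩
      simp only [this.neg_pow]
      ring
    · exact ⟨k, rfl⟩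

theorem eq_of_hasDerivAt_zero {f : ℝ → ℝ} {a b : ℝ} (hab : a < b)
    (hc : ContinuousOn f (Set.Icc a b)) (hd : ∀ x ∈ Set.Ioo a b, HasDerivAt f 0 x) :
    f b = f a := by
  obtain ⟨c, -, h⟩ := exists_hasDerivAt_eq_slope f (fun _ => 0) hab hc hd
  have : b - a ≠ 0 := by linarith
  field_simp at h
  linarith

theorem continuousAt_log_mul_log_one_sub_zero :
    ContinuousAt (fun x : ℝ => log x * log (1 - x)) 0 := by
  have hd : HasDerivAt (fun x : ℝ => log (1 - x)) (-1 / (1 - 0)) 0 :=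
    ((hasDerivAt_id (0 : ℝ)).const_sub 1).log (by norm_num)
  have hO : (fun x : ℝ => log (1 - x)) =O[nhds 0] fun x => x := by
    simpa using hd.isBigO_sub
  have hO' := (Asymptotics.isBigO_refl log (nhds 0)).mul hO
  have ht : Filter.Tendsto (fun x : ℝ => log x * x) (nhds 0) (nhds 0) := by
    simpa [mul_comm] using Real.continuous_mul_log.tendsto 0
  simpa [ContinuousAt] using hO'.trans_tendsto ht

/-- Euler's reflection formula. -/
theorem dilog_add_dilog_one_sub {x : ℝ} (h0 : 0 < x) (h1 : x < 1) :
    dilog x + dilog (1 - x) = π ^ 2 / 6 - log x * log (1 - x) := by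
  have h := eq_of_hasDerivAt_zero
    (f := fun y => dilog y + dilog (1 - y) + log y * log (1 - y)) h0 ?_ ?_
  · simp [dilog_zero, dilog_one] at h
    linarith
  · refine ((continuousOn_dilog.mono ?_).add (continuousOn_dilog.comp (by fun_prop) ?_)).add ?_
    · exact Set.Icc_subset_Icc (by norm_num) h1.le
    · intro y hy
      exact ⟨by linarith [hy.2], by linarith [hy.1]⟩
    · intro y hy
      rcases hy.1.eq_or_lt with rfl | hy0
      · exact continuousAt_log_mul_log_one_sub_zero.continuousWithinAt
      · have h2 : 1 - y ≠ 0 := by linarith [hy.2]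
        exact ((continuousAt_log hy0.ne').mul
          (ContinuousAt.log (by fun_prop) h2)).continuousWithinAt
  · intro y hy
    obtain ⟨hy0, hyx⟩ := hy
    have h2 : 0 < 1 - y := by linarith
    have hs : HasDerivAt (fun y : ℝ => 1 - y) (-1) y := (hasDerivAt_id y).const_sub 1
    have d1 := hasDerivAt_dilog (x := y) (by rw [abs_lt]; constructor <;> linarith) hy0.ne'
    have d2 := (hasDerivAt_dilog (x := 1 - y)
      (by rw [abs_lt]; constructor <;> linarith) h2.ne').comp y hs
    have d3 := (hasDerivAt_log hy0.ne').mul (hs.log h2.ne')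
    convert! (d1.add d2).add d3 using 1
    rw [sub_sub_cancel]
    field_simp
    ring

/-- Landen's identity. -/
theorem dilog_add_dilog_div_sub_one {x : ℝ} (h0 : 0 < x) (h1 : x < 1 / 2) :
    dilog x + dilog (x / (x - 1)) = -log (1 - x) ^ 2 / 2 := by
  have hmem : ∀ y ∈ Set.Icc 0 x, -1 < y / (y - 1) ∧ y / (y - 1) ≤ 0 := by
    intro y hy
    have h2 : y - 1 < 0 := by linarith [hy.2]
    exact ⟨by rw [lt_div_iff_of_neg h2]; linarith [hy.2],
      div_nonpos_of_nonneg_of_nonpos hy.1 h2.le⟩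
  have h := eq_of_hasDerivAt_zero
    (f := fun y => dilog y + dilog (y / (y - 1)) + log (1 - y) ^ 2 / 2) h0 ?_ ?_
  · simp [dilog_zero] at h
    linarith
  · refine ((continuousOn_dilog.mono ?_).add (continuousOn_dilog.comp ?_ ?_)).add ?_
    · exact Set.Icc_subset_Icc (by norm_num) (by linarith)
    · refine continuousOn_id.div (by fun_prop) fun y hy => ?_
      linarith [hy.2]
    · intro y hy
      exact ⟨(hmem y hy).1.le, by linarith [(hmem y hy).2]⟩
    · refine ((ContinuousOn.log (by fun_prop) fun y hy => ?_).pow 2).div_const 2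
      linarith [hy.2]
  · intro y hy
    obtain ⟨hy0, hyx⟩ := hy
    have h2 : 1 - y ≠ 0 := by linarith
    have h3 : y - 1 ≠ 0 := by linarith
    have hm := hmem y ⟨hy0.le, hyx.le⟩
    have hs : HasDerivAt (fun y : ℝ => 1 - y) (-1) y := (hasDerivAt_id y).const_sub 1
    have hq := (hasDerivAt_id y).div ((hasDerivAt_id y).sub_const 1) h3
    have d1 := hasDerivAt_dilog (x := y) (by rw [abs_lt]; constructor <;> linarith) hy0.ne'
    have d2 := (hasDerivAt_dilog (x := y / (y - 1))
      (by rw [abs_lt]; constructor <;> linarith) (div_ne_zero hy0.ne' h3)).comp y hq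
    have d3 := ((hs.log h2).pow 2).div_const 2
    convert! (d1.add d2).add d3 using 1
    have hl : log (1 - y / (y - 1)) = -log (1 - y) := by
      rw [← log_inv]
      congr 1
      field_simp
      ring
    rw [hl]
    simp only [id]
    field_simp
    ring

/-- `Li₂((3-√5)/2) = π²/15 - (log((1+√5)/2))²`. -/
theorem li2_special_value :
    ∑' n : ℕ, ((3 - Real.sqrt 5) / 2) ^ (n + 1) / ((n : ℝ) + 1) ^ 2
      = π ^ 2 / 15 - Real.log ((1 + Real.sqrt 5) / 2) ^ 2 := by
  change dilog ((3 - √5) / 2) = _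
  have h5 : √5 ^ 2 = 5 := Real.sq_sqrt (by norm_num)
  have hlo : 2 < √5 := Real.lt_sqrt_of_sq_lt (by norm_num)
  have hhi : √5 < 3 := (Real.sqrt_lt' (by norm_num)).mpr (by norm_num)
  obtain ⟨a, ha⟩ : ∃ a, a = (√5 - 1) / 2 := ⟨_, rfl⟩
  have ha0 : 0 < a := by linarith
  have ha1 : a < 1 := by linarith
  have hQ : (3 - √5) / 2 = a ^ 2 := by rw [ha]; linarith
  have hQa : 1 - a ^ 2 = a := by rw [← hQ, ha]; ring
  have hφ : (1 + √5) / 2 = a⁻¹ := by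
    refine eq_inv_of_mul_eq_one_left ?_
    rw [ha]
    linarith
  have hdiv : a ^ 2 / (a ^ 2 - 1) = -a := by
    rw [show a ^ 2 - 1 = -a by linarith]
    field_simp
  rw [hQ, hφ, log_inv]
  have e1 := dilog_add_dilog_one_sub (x := a ^ 2) (by positivity) (by linarith)
  have e2 := dilog_add_dilog_div_sub_one (x := a ^ 2) (by positivity) (by linarith)
  have e3 := dilog_add_dilog_neg (x := a) ⟨by linarith, ha1.le⟩
  rw [hQa, log_pow] at e1
  rw [hdiv, hQa] at e2
  push_cast at e1
  linarith
end

section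
/- Fix M > 0. Write τ = x + iy with x ∈ ℝ, y > 0, and q = e^(2πiτ). Then for |x| ≤ My, as y → 0⁺, (−q;q)_∞ = (1/√2) · exp(πi/(24τ)) + O( y · exp((π/24) Im(−1/τ)) ). -/
open Real Filter Topology Complex

/-- Euler's identity `(-q;q)_∞ (q;q)_∞ = (q²;q²)_∞`. -/
lemma tprod_one_add_pow_mul_tprod_one_sub_pow {q : ℂ} (hq : ‖q‖ < 1) :
    (∏' n : ℕ, (1 + q ^ (n + 1))) * ∏' n : ℕ, (1 - q ^ (n + 1)) =
      ∏' n : ℕ, (1 - (q ^ 2) ^ (n + 1)) := by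
  have hadd : Multipliable fun n : ℕ ↦ 1 + q ^ (n + 1) :=
    multipliable_one_add_of_summable (by
      simpa using (summable_nat_add_iff 1).mpr (summable_geometric_of_lt_one (norm_nonneg _) hq))
  rw [← hadd.tprod_mul (ModularForm.multipliable_one_sub_pow hq)]
  exact tprod_congr fun n ↦ by ring

lemma tprod_one_sub_pow_ne_zero {q : ℂ} (hq : ‖q‖ < 1) :
    ∏' n : ℕ, (1 - q ^ (n + 1)) ≠ 0 := by
  simp_rw [sub_eq_add_neg]
  refine tprod_one_add_ne_zero_of_summable (fun n h ↦ ?_) ?_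
  · have h1 : q ^ (n + 1) = 1 := by linear_combination -h
    have h2 := pow_lt_one₀ (norm_nonneg q) hq n.succ_ne_zero
    rw [← norm_pow, h1, norm_one] at h2
    exact lt_irrefl _ h2
  · simpa using (summable_nat_add_iff 1).mpr (summable_geometric_of_lt_one (norm_nonneg _) hq)

lemma eta_eq_cexp_mul_tprod (z : ℂ) :
    ModularForm.eta z = cexp (π * I * z / 12) *
      ∏' n : ℕ, (1 - cexp (2 * π * I * z) ^ (n + 1)) := by
  simp only [ModularForm.eta, ModularForm.eta_q_eq_pow, Function.Periodic.qParam]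
  congr 2
  push_cast
  ring

/-- The inversion formula for `(q;q)_∞`. -/
lemma cexp_mul_tprod_one_sub_inversion {z : ℂ} (hz : 0 < z.im) :
    cexp (-(π * I / (12 * z))) * ∏' n : ℕ, (1 - cexp (-(2 * π * I / z)) ^ (n + 1)) =
      (Complex.sqrt I)⁻¹ * (Complex.sqrt z * (cexp (π * I * z / 12) *
        ∏' n : ℕ, (1 - cexp (2 * π * I * z) ^ (n + 1)))) := by
  have hz0 : z ≠ 0 := by rintro rfl; simp at hz
  have h : ModularForm.eta (-1 / z) = (Complex.sqrt I)⁻¹ * (Complex.sqrt z * ModularForm.eta z) :=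
    ModularForm.eta_comp_eq_csqrt_I_inv hz
  rw [eta_eq_cexp_mul_tprod, eta_eq_cexp_mul_tprod] at h
  convert h using 2
  · congr 1; field_simp
  · congr! 5; field_simp

lemma csqrt_ofReal_mul {r : ℝ} (hr : 0 < r) {z : ℂ} (hz : z ≠ 0) :
    Complex.sqrt (r * z) = (√r : ℝ) * Complex.sqrt z := by
  have hr' : (r : ℂ) ≠ 0 := mod_cast hr.ne'
  have h : ((√r : ℝ) : ℂ) = (r : ℂ) ^ (2⁻¹ : ℂ) := by
    rw [Real.sqrt_eq_rpow, Complex.ofReal_cpow hr.le]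
    norm_num
  rw [h, Complex.sqrt, Complex.sqrt, Complex.cpow_def_of_ne_zero (mul_ne_zero hr' hz),
    Complex.log_ofReal_mul hr hz, Complex.ofReal_log hr.le, add_mul, Complex.exp_add,
    ← Complex.cpow_def_of_ne_zero hr', ← Complex.cpow_def_of_ne_zero hz]

/-- The inversion formula for `(-q;q)_∞`, in terms of the nome `s = exp(-πi/τ)`. -/
lemma tprod_one_add_pow_inversion {τ : ℂ} (hτ : 0 < τ.im) :
    ∏' n : ℕ, (1 + cexp (2 * π * I * τ) ^ (n + 1)) =
      (1 / √2 : ℝ) * cexp (π * I / (24 * τ)) * (cexp (-(π * I / 12) * τ) *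
        ((∏' n : ℕ, (1 - cexp (-(π * I / τ)) ^ (n + 1))) /
          ∏' n : ℕ, (1 - (cexp (-(π * I / τ)) ^ 2) ^ (n + 1)))) := by
  have hτ0 : τ ≠ 0 := by rintro rfl; simp at hτ
  have hq : ‖cexp (2 * π * I * τ)‖ < 1 := UpperHalfPlane.norm_exp_two_pi_I_lt_one ⟨τ, hτ⟩
  have hs : ‖cexp (-(π * I / τ)) ^ 2‖ < 1 := by
    have h := UpperHalfPlane.norm_exp_two_pi_I_lt_one ⟨-1 / τ, by
      simpa [neg_div] using UpperHalfPlane.im_inv_neg_coe_pos ⟨τ, hτ⟩⟩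
    rw [← Complex.exp_nat_mul]
    convert h using 3
    simp only
    push_cast
    ring
  have hsqrt : Complex.sqrt (2 * τ) = (√2 : ℝ) * Complex.sqrt τ := by
    simpa using csqrt_ofReal_mul two_pos hτ0
  have h1 := cexp_mul_tprod_one_sub_inversion hτ
  have h2 := cexp_mul_tprod_one_sub_inversion (z := 2 * τ) (by simpa using hτ)
  have e1 : cexp (-(2 * π * I / τ)) = cexp (-(π * I / τ)) ^ 2 := by
    rw [← Complex.exp_nat_mul]; congr 1; push_cast; ring
  have e2 : cexp (-(2 * π * I / (2 * τ))) = cexp (-(π * I / τ)) := by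
    congr 2; field_simp
  have e3 : cexp (2 * π * I * (2 * τ)) = cexp (2 * π * I * τ) ^ 2 := by
    rw [← Complex.exp_nat_mul]; congr 1; push_cast; ring
  have e4 : cexp (-(π * I / (12 * (2 * τ)))) = (cexp (π * I / (24 * τ)))⁻¹ := by
    rw [← Complex.exp_neg]; congr 2; field_simp; norm_num
  have e5 : cexp (-(π * I / (12 * τ))) = (cexp (π * I / (24 * τ)))⁻¹ ^ 2 := by
    rw [← Complex.exp_neg, ← Complex.exp_nat_mul]; congr 1; field_simp; norm_num
  have e6 : cexp (π * I * (2 * τ) / 12) = (cexp (-(π * I / 12) * τ))⁻¹ ^ 2 := by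
    rw [← Complex.exp_neg, ← Complex.exp_nat_mul]; congr 1; push_cast; ring
  have e7 : cexp (π * I * τ / 12) = (cexp (-(π * I / 12) * τ))⁻¹ := by
    rw [← Complex.exp_neg]; congr 1; ring
  rw [e1, e5, e7] at h1
  rw [e2, e3, e4, e6, hsqrt, ← tprod_one_add_pow_mul_tprod_one_sub_pow hq] at h2
  have hP := tprod_one_sub_pow_ne_zero hq
  have hS := tprod_one_sub_pow_ne_zero hs
  have hsτ : Complex.sqrt τ ≠ 0 := by simp [Complex.sqrt, hτ0]
  have hsI : Complex.sqrt I ≠ 0 := by simp [Complex.sqrt]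
  have h2' : ((√2 : ℝ) : ℂ) ≠ 0 := by simp
  have hE := Complex.exp_ne_zero (π * I / (24 * τ))
  have hF := Complex.exp_ne_zero (-(π * I / 12) * τ)
  generalize (∏' n : ℕ, (1 + cexp (2 * π * I * τ) ^ (n + 1))) = G at *
  generalize (∏' n : ℕ, (1 - cexp (2 * π * I * τ) ^ (n + 1))) = P at *
  generalize (∏' n : ℕ, (1 - (cexp (-(π * I / τ)) ^ 2) ^ (n + 1))) = S at *
  generalize (∏' n : ℕ, (1 - cexp (-(π * I / τ)) ^ (n + 1))) = R at *
  generalize cexp (π * I / (24 * τ)) = E at *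
  generalize cexp (-(π * I / 12) * τ) = F at *
  generalize Complex.sqrt τ = t at *
  generalize Complex.sqrt I = u at *
  push_cast
  generalize ((√2 : ℝ) : ℂ) = w at *
  field_simp at h1 h2 ⊢
  refine mul_left_cancel₀ (mul_ne_zero (mul_ne_zero hE hsτ) hP) ?_
  linear_combination F * R * h1 - S * h2

lemma isBigO_cexp_mul_tprod_one_sub_div_sub_one (c : ℂ) :
    (fun p : ℂ × ℂ ↦ cexp (c * p.1) * ((∏' n : ℕ, (1 - p.2 ^ (n + 1))) /
      ∏' n : ℕ, (1 - (p.2 ^ 2) ^ (n + 1))) - 1) =O[𝓝 0] fun p ↦ p := by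
  have hP : DifferentiableAt ℂ (fun q : ℂ ↦ ∏' n : ℕ, (1 - q ^ (n + 1))) 0 :=
    ModularForm.differentiableOn_tprod_one_sub_pow.differentiableAt
      (Metric.ball_mem_nhds 0 one_pos)
  have h1 : DifferentiableAt ℂ (fun p : ℂ × ℂ ↦ ∏' n : ℕ, (1 - p.2 ^ (n + 1))) 0 :=
    DifferentiableAt.comp (g := fun q : ℂ ↦ ∏' n : ℕ, (1 - q ^ (n + 1))) (0 : ℂ × ℂ) hP
      differentiableAt_snd
  have h2 : DifferentiableAt ℂ (fun p : ℂ × ℂ ↦ ∏' n : ℕ, (1 - (p.2 ^ 2) ^ (n + 1))) 0 :=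
    DifferentiableAt.comp (g := fun q : ℂ ↦ ∏' n : ℕ, (1 - q ^ (n + 1)))
      (f := fun p : ℂ × ℂ ↦ p.2 ^ 2) (0 : ℂ × ℂ) (by simpa using hP) (by fun_prop)
  have h3 : DifferentiableAt ℂ (fun p : ℂ × ℂ ↦ cexp (c * p.1) *
      ((∏' n : ℕ, (1 - p.2 ^ (n + 1))) / ∏' n : ℕ, (1 - (p.2 ^ 2) ^ (n + 1)))) 0 := by
    simp_rw [div_eq_mul_inv]
    exact DifferentiableAt.mul (by fun_prop) (h1.mul (h2.inv (by simp)))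
  simpa using h3.isBigO_sub

/-- For `|x| ≤ My`, as `y → 0⁺`,
`(-q;q)_∞ = (1/√2) e^{πi/(24τ)} + O(y e^{(π/24) Im(-1/τ)})` where `τ = x + iy`,
`q = e^{2πiτ}`. -/
theorem neg_q_pochhammer_asymptotic (M : ℝ) (hM : 0 < M) :
    ∃ C > (0 : ℝ), ∃ y₀ > (0 : ℝ), ∀ x y : ℝ, 0 < y → y < y₀ → |x| ≤ M * y →
      ‖(∏' j : ℕ,
          (1 + Complex.exp (2 * π * Complex.I * ((x : ℂ) + (y : ℂ) * Complex.I)) ^ (j + 1)))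
          - (1 / Real.sqrt 2 : ℝ) *
            Complex.exp (π * Complex.I / (24 * ((x : ℂ) + (y : ℂ) * Complex.I)))‖
        ≤ C * y * Real.exp (π / 24 * ((-1) / ((x : ℂ) + (y : ℂ) * Complex.I)).im) := by
  obtain ⟨K, hK, hbound⟩ :=
    (isBigO_cexp_mul_tprod_one_sub_div_sub_one (-(π * I / 12))).exists_pos
  obtain ⟨ε, hε, hball⟩ := Metric.eventually_nhds_iff_ball.mp hbound.bound
  have hA : 0 < M ^ 2 + M + 1 := by positivity
  refine ⟨K * (M ^ 2 + M + 1), by positivity, ε / (M ^ 2 + M + 1), by positivity,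
    fun x y hy hy₀ hx ↦ ?_⟩
  rw [lt_div_iff₀ hA] at hy₀
  set τ : ℂ := (x : ℂ) + (y : ℂ) * I with hτ
  have hτre : τ.re = x := by simp [hτ]
  have hτim : τ.im = y := by simp [hτ]
  have hnormSq : Complex.normSq τ = x ^ 2 + y ^ 2 := by
    rw [Complex.normSq_apply, hτre, hτim]; ring
  have hx2 : x ^ 2 ≤ (M * y) ^ 2 := sq_le_sq.mpr (by rwa [abs_of_pos (mul_pos hM hy)])
  have hτnorm : ‖τ‖ ≤ (M ^ 2 + M + 1) * y := by
    have h := Complex.norm_le_abs_re_add_abs_im τ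
    rw [hτre, hτim, abs_of_pos hy] at h
    nlinarith [mul_pos (pow_pos hM 2) hy]
  have hsnorm : ‖cexp (-(π * I / τ))‖ ≤ (M ^ 2 + M + 1) * y := by
    have hre : (-(π * I / τ)).re = -(π * (y / (x ^ 2 + y ^ 2))) := by
      simp [Complex.div_re, hτre, hτim, hnormSq]
      ring
    have hpos : 0 < y / (x ^ 2 + y ^ 2) := by positivity
    rw [Complex.norm_exp, hre, Real.exp_neg]
    calc (Real.exp (π * (y / (x ^ 2 + y ^ 2))))⁻¹ ≤ (y / (x ^ 2 + y ^ 2))⁻¹ := by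
          refine inv_anti₀ hpos ?_
          nlinarith [Real.add_one_le_exp (π * (y / (x ^ 2 + y ^ 2))), Real.pi_gt_three]
      _ ≤ (M ^ 2 + M + 1) * y := by
          rw [inv_div, div_le_iff₀ hy]
          nlinarith [mul_pos hM (pow_pos hy 2)]
  have hpair : ‖(τ, cexp (-(π * I / τ)))‖ ≤ (M ^ 2 + M + 1) * y := by
    rw [Prod.norm_mk]; exact max_le hτnorm hsnorm
  have hmain := (hball (τ, cexp (-(π * I / τ))) (by
    rw [mem_ball_zero_iff]; linarith)).trans (mul_le_mul_of_nonneg_left hpair hK.le)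
  have hexp : ‖cexp (π * I / (24 * τ))‖ = Real.exp (π / 24 * ((-1) / τ).im) := by
    rw [Complex.norm_exp]
    congr 1
    rw [show (π * I / (24 * τ) : ℂ) = ((π / 24 : ℝ) : ℂ) * (I * (1 / τ)) by push_cast; field_simp,
      Complex.re_ofReal_mul, Complex.I_mul_re, neg_div, Complex.neg_im]
  have hsqrt : ‖((1 / √2 : ℝ) : ℂ)‖ ≤ 1 := by
    rw [Complex.norm_real, Real.norm_of_nonneg (by positivity), div_le_one (by positivity)]
    exact Real.one_le_sqrt.mpr (by norm_num)
  rw [tprod_one_add_pow_inversion (by rwa [hτim]), ← mul_sub_one, norm_mul, norm_mul, hexp]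
  calc _ ≤ 1 * Real.exp (π / 24 * ((-1) / τ).im) * (K * ((M ^ 2 + M + 1) * y)) := by
        gcongr
    _ = _ := by ring
end

section
/- Fix M > 0. Write τ = x + iy with x ∈ ℝ, y > 0, and q = e^(2πiτ). Then for My < |x| ≤ 1/2, as y → 0⁺, | (q²;q²)_∞ / ((q;q)_∞)² | ≪ √(y/2) · exp( (1/y)( π/8 − (1/π)(1 − 1/√(1 + M²)) ) ), where the implied constant depends only on M. -/
open Real Filter Topology Complex

/-- Comparison of `2 artanh z` with `2 artanh ‖z‖`, keeping the linear term exact. -/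
theorem log_norm_one_add_sub_le {z : ℂ} (hz : ‖z‖ < 1) :
    Real.log ‖1 + z‖ - Real.log ‖1 - z‖ ≤
      Real.log (1 + ‖z‖) - Real.log (1 - ‖z‖) + 2 * (z.re - ‖z‖) := by
  have key : ∀ w : ℂ, ‖w‖ < 1 → HasSum (fun n : ℕ => ((-1) ^ (n + 1) + 1) / (n : ℝ) * (w ^ n).re)
      (Real.log ‖1 + w‖ - Real.log ‖1 - w‖) := by
    intro w hw
    have h := Complex.hasSum_re
      ((Complex.hasSum_taylorSeries_log hw).add (Complex.hasSum_taylorSeries_neg_log hw))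
    rw [Complex.add_re, Complex.neg_re, Complex.log_re, Complex.log_re, ← sub_eq_add_neg] at h
    refine h.congr_fun ?_
    intro n
    rw [← Complex.re_ofReal_mul]
    congr 1
    push_cast
    ring
  have hρ := key (‖z‖ : ℂ) (by simpa using hz)
  have e1 : ‖(1 : ℂ) + (‖z‖ : ℂ)‖ = 1 + ‖z‖ := by
    rw [← Complex.ofReal_one, ← Complex.ofReal_add, Complex.norm_real, Real.norm_of_nonneg]
    positivity
  have e2 : ‖(1 : ℂ) - (‖z‖ : ℂ)‖ = 1 - ‖z‖ := by
    rw [← Complex.ofReal_one, ← Complex.ofReal_sub, Complex.norm_real, Real.norm_of_nonneg]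
    linarith
  rw [e1, e2] at hρ
  refine hasSum_le ?_ (key z hz) (hρ.add (hasSum_ite_eq 1 (2 * (z.re - ‖z‖))))
  intro n
  by_cases hn : n = 1
  · subst hn
    norm_num
    linarith
  · simp only [hn, if_false, add_zero]
    have hc : (0 : ℝ) ≤ ((-1) ^ (n + 1) + 1) / (n : ℝ) := by
      refine div_nonneg ?_ (Nat.cast_nonneg n)
      rcases neg_one_pow_eq_or ℝ (n + 1) with h | h <;> rw [h] <;> norm_num
    refine mul_le_mul_of_nonneg_left ?_ hc
    rw [← Complex.ofReal_pow, Complex.ofReal_re, ← norm_pow]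
    exact Complex.re_le_norm _

/-- `∑ 1 / (2k+1)² = π² / 8`. -/
theorem hasSum_one_div_odd_sq :
    HasSum (fun k : ℕ => 1 / (2 * (k : ℝ) + 1) ^ 2) (π ^ 2 / 8) := by
  have h := hasSum_zeta_two
  have he : HasSum (fun k : ℕ => (1 : ℝ) / ((2 * k : ℕ) : ℝ) ^ 2) (1 / 4 * (π ^ 2 / 6)) := by
    convert! h.mul_left (1 / 4) using 2 with k
    push_cast
    ring
  have hs : Summable (fun k : ℕ => (1 : ℝ) / ((2 * k + 1 : ℕ) : ℝ) ^ 2) :=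
    h.summable.comp_injective (i := fun k : ℕ => 2 * k + 1) (fun a b hab => by simpa using hab)
  have hu := (HasSum.even_add_odd (f := fun n : ℕ => (1 : ℝ) / (n : ℝ) ^ 2) he hs.hasSum).unique h
  have hv : ∑' k : ℕ, (1 : ℝ) / ((2 * k + 1 : ℕ) : ℝ) ^ 2 = π ^ 2 / 8 := by linarith
  rw [← hv]
  exact_mod_cast hs.hasSum

/-- The Bose–Einstein factor satisfies `1 / (e ^ u - 1) ≤ 1 / u - e ^ (-u) / 2`. -/
theorem exp_neg_div_one_sub_exp_neg_le {u : ℝ} (hu : 0 < u) :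
    Real.exp (-u) / (1 - Real.exp (-u)) ≤ 1 / u - Real.exp (-u) / 2 := by
  have hE : 1 + u + u ^ 2 / 2 ≤ Real.exp u := Real.quadratic_le_exp_of_nonneg hu.le
  rw [Real.exp_neg]
  set E := Real.exp u
  have hE1 : 0 < E - 1 := by nlinarith
  have hE0 : 0 < E := by linarith
  have e : 1 / u - E⁻¹ / 2 - E⁻¹ / (1 - E⁻¹) =
      (2 * E * (E - 1) - u * (3 * E - 1)) / (2 * u * E * (E - 1)) := by
    have : E - 1 ≠ 0 := hE1.ne'
    have h2 : 1 - E⁻¹ = (E - 1) / E := by field_simp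
    rw [h2]
    field_simp
    ring
  have : 0 ≤ 1 / u - E⁻¹ / 2 - E⁻¹ / (1 - E⁻¹) := by
    rw [e]
    refine div_nonneg ?_ (by positivity)
    obtain ⟨d, hd, hd_eq⟩ : ∃ d, 0 ≤ d ∧ E = 1 + u + u ^ 2 / 2 + d :=
      ⟨E - (1 + u + u ^ 2 / 2), by linarith, by ring⟩
    rw [hd_eq]
    have : 2 * (1 + u + u ^ 2 / 2 + d) * (1 + u + u ^ 2 / 2 + d - 1) -
        u * (3 * (1 + u + u ^ 2 / 2 + d) - 1) =
        u ^ 3 / 2 + u ^ 4 / 2 + 2 * d + u * d + 2 * u ^ 2 * d + 2 * d ^ 2 := by ring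
    rw [this]
    positivity
  linarith

/-- Upper bound for the logarithm of the partial products of `(-r; r)_∞ / (r; r)_∞`
at `r = e ^ (-t)`. -/
theorem sum_log_one_add_sub_le {t : ℝ} (ht : 0 < t) (N : ℕ) :
    ∑ n ∈ Finset.range N, (Real.log (1 + Real.exp (-t) ^ (n + 1)) -
      Real.log (1 - Real.exp (-t) ^ (n + 1))) ≤ π ^ 2 / (4 * t) + Real.log t / 2 := by
  set r := Real.exp (-t) with hr
  have hr0 : 0 < r := Real.exp_pos _
  have hr1 : r < 1 := by rw [hr, Real.exp_lt_one_iff]; linarith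
  have hL := hasSum_sum (s := Finset.range N) fun n _ =>
    Real.hasSum_log_sub_log_of_abs_lt_one (x := r ^ (n + 1))
      (by rw [abs_of_pos (by positivity)]; exact pow_lt_one₀ hr0.le hr1 (by omega))
  have hR := (hasSum_one_div_odd_sq.mul_left (2 / t)).sub
    ((Real.hasSum_log_sub_log_of_abs_lt_one (x := r)
      (by rwa [abs_of_pos hr0])).mul_left (1 / 2))
  have hle := hasSum_le (fun k => ?_) hL hR
  · refine hle.trans ?_
    have h1 : 0 ≤ Real.log (1 + r) := Real.log_nonneg (by linarith)
    have h2 : Real.log (1 - r) ≤ Real.log t := by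
      refine Real.log_le_log (by linarith) ?_
      have := Real.add_one_le_exp (-t)
      linarith
    have h3 : 2 / t * (π ^ 2 / 8) = π ^ 2 / (4 * t) := by
      field_simp
      norm_num
    linarith
  · set m : ℕ := 2 * k + 1 with hm
    have hm0 : (0 : ℝ) < 2 * k + 1 := by positivity
    have hrm : r ^ m = Real.exp (-((2 * k + 1) * t)) := by
      rw [hr, ← Real.exp_nat_mul, hm]
      push_cast
      ring_nf
    have hrm1 : r ^ m < 1 := pow_lt_one₀ hr0.le hr1 (by omega)
    have hgeom : ∑ n ∈ Finset.range N, (r ^ (n + 1)) ^ m ≤ r ^ m / (1 - r ^ m) := by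
      have hg : HasSum (fun n : ℕ => (r ^ (n + 1)) ^ m) (r ^ m / (1 - r ^ m)) := by
        refine ((hasSum_geometric_of_lt_one (by positivity) hrm1).mul_left (r ^ m)).congr_fun ?_
        intro n
        ring
      exact sum_le_hasSum _ (fun _ _ => by positivity) hg
    have hb := exp_neg_div_one_sub_exp_neg_le (u := (2 * k + 1) * t) (by positivity)
    rw [← hrm] at hb
    rw [← Finset.mul_sum]
    calc 2 * (1 / (2 * (k : ℝ) + 1)) * ∑ n ∈ Finset.range N, (r ^ (n + 1)) ^ m
        ≤ 2 * (1 / (2 * (k : ℝ) + 1)) * (1 / ((2 * k + 1) * t) - r ^ m / 2) :=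
          mul_le_mul_of_nonneg_left (hgeom.trans hb) (by positivity)
      _ = _ := by
          field_simp

/-- The norm of `(q²; q²)_∞ / (q; q)_∞²` is controlled by its value at `‖q‖` and the distance
from `q` to `1`. -/
theorem norm_tprod_div_le {q : ℂ} {t : ℝ} (ht : 0 < t) (hq : ‖q‖ = Real.exp (-t)) :
    ‖(∏' j : ℕ, (1 - q ^ (2 * (j + 1)))) / (∏' j : ℕ, (1 - q ^ (j + 1))) ^ 2‖ ≤
      Real.exp (π ^ 2 / (4 * t) + Real.log t / 2 +
        2 * ((q / (1 - q)).re - ‖q‖ / (1 - ‖q‖))) := by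
  have hq1 : ‖q‖ < 1 := by rw [hq, Real.exp_lt_one_iff]; linarith
  have hpow : ∀ n : ℕ, ‖q ^ (n + 1)‖ < 1 := fun n => by
    rw [norm_pow]; exact pow_lt_one₀ (norm_nonneg _) hq1 (by omega)
  have hne : ∀ w : ℂ, ‖w‖ < 1 → 1 - w ≠ 0 ∧ 1 + w ≠ 0 := by
    intro w hw
    constructor <;> intro h
    · rw [← sub_eq_zero.mp h] at hw
      simp at hw
    · rw [← norm_neg, ← eq_neg_of_add_eq_zero_left h] at hw
      simp at hw
  by_cases h0 : ∏' j : ℕ, (1 - q ^ (j + 1)) = 0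
  · rw [h0]
    simp only [ne_eq, OfNat.ofNat_ne_zero, not_false_eq_true, zero_pow, div_zero, norm_zero]
    positivity
  have hden := (ModularForm.multipliable_one_sub_pow hq1).hasProd.tendsto_prod_nat
  have hnum : Tendsto (fun N => ∏ j ∈ Finset.range N, (1 - q ^ (2 * (j + 1)))) atTop
      (𝓝 (∏' j : ℕ, (1 - q ^ (2 * (j + 1))))) := by
    have hq2 : ‖q ^ 2‖ < 1 := hpow 1
    simpa only [← pow_mul] using (ModularForm.multipliable_one_sub_pow hq2).hasProd.tendsto_prod_nat
  have hlim := (hnum.div (hden.pow 2) (pow_ne_zero 2 h0)).norm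
  have hgq : HasSum (fun n : ℕ => (q ^ (n + 1)).re) (q / (1 - q)).re := by
    refine Complex.hasSum_re (((hasSum_geometric_of_norm_lt_one hq1).mul_left q).congr_fun ?_)
    intro n
    ring
  have hgr : HasSum (fun n : ℕ => ‖q ^ (n + 1)‖) (‖q‖ / (1 - ‖q‖)) := by
    refine ((hasSum_geometric_of_lt_one (norm_nonneg q) hq1).mul_left ‖q‖).congr_fun ?_
    intro n
    rw [norm_pow]
    ring
  have hexp := (Real.continuous_exp.tendsto _).comp
    (((hgq.sub hgr).mul_left 2).tendsto_sum_nat.const_add (π ^ 2 / (4 * t) + Real.log t / 2))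
  refine le_of_tendsto_of_tendsto' hlim hexp fun N => ?_
  have hterm : (∏ j ∈ Finset.range N, (1 - q ^ (2 * (j + 1)))) /
      (∏ j ∈ Finset.range N, (1 - q ^ (j + 1))) ^ 2 =
      ∏ j ∈ Finset.range N, (1 + q ^ (j + 1)) / (1 - q ^ (j + 1)) := by
    rw [← Finset.prod_pow, ← Finset.prod_div_distrib]
    refine Finset.prod_congr rfl fun j _ => ?_
    have := (hne _ (hpow j)).1
    field_simp
    ring
  simp only [Pi.div_apply, Function.comp_apply]
  rw [hterm, norm_prod]
  have hfac : ∀ j : ℕ, ‖(1 + q ^ (j + 1)) / (1 - q ^ (j + 1))‖ =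
      Real.exp (Real.log ‖1 + q ^ (j + 1)‖ - Real.log ‖1 - q ^ (j + 1)‖) := fun j => by
    have := hne _ (hpow j)
    rw [Real.exp_sub, Real.exp_log (norm_pos_iff.mpr this.2),
      Real.exp_log (norm_pos_iff.mpr this.1), norm_div]
  simp only [hfac]
  rw [← Real.exp_sum]
  refine Real.exp_le_exp.mpr ?_
  have hs := Finset.sum_le_sum fun j (_ : j ∈ Finset.range N) => log_norm_one_add_sub_le (hpow j)
  rw [Finset.sum_add_distrib] at hs
  have hb := sum_log_one_add_sub_le ht N
  rw [← hq] at hb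
  simp only [← norm_pow] at hb
  linarith

/-- Lower bound for the distance from `q = e ^ (-t + 2πix)` to `1`. -/
theorem exp_neg_sq_mul_le_norm_one_sub_sq {x t : ℝ} (ht : 0 < t) :
    Real.exp (-t) ^ 2 * (t ^ 2 + (2 * Real.sin (π * x)) ^ 2) ≤
      ‖1 - Complex.exp ((-t : ℝ) + (2 * (π * x) : ℝ) * Complex.I)‖ ^ 2 := by
  rw [Complex.exp_add_mul_I, ← Complex.ofReal_exp, ← Complex.ofReal_cos, ← Complex.ofReal_sin,
    ← Complex.normSq_eq_norm_sq, Complex.normSq_apply]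
  simp only [Complex.sub_re, Complex.sub_im, Complex.one_re, Complex.one_im, Complex.mul_re,
    Complex.mul_im, Complex.add_re, Complex.add_im, Complex.ofReal_re, Complex.ofReal_im,
    Complex.I_re, Complex.I_im, Real.cos_two_mul, Real.sin_two_mul]
  have hr0 : 0 < Real.exp (-t) := Real.exp_pos _
  have hr1 : Real.exp (-t) ≤ 1 := Real.exp_le_one_iff.mpr (by linarith)
  have hrt : Real.exp (-t) * t ≤ 1 - Real.exp (-t) := by
    have h := Real.add_one_le_exp t
    have h' : Real.exp (-t) * Real.exp t = 1 := by rw [← Real.exp_add]; simp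
    nlinarith
  have hsc := Real.sin_sq_add_cos_sq (π * x)
  set r := Real.exp (-t)
  set s := Real.sin (π * x)
  set c := Real.cos (π * x)
  have e : (1 - r * (2 * c ^ 2 - 1)) ^ 2 + (r * (2 * s * c)) ^ 2 =
      (1 - r) ^ 2 + r * (2 * s) ^ 2 := by
    have hc : c ^ 2 = 1 - s ^ 2 := by linarith
    have : (r * (2 * s * c)) ^ 2 = 4 * r ^ 2 * s ^ 2 * c ^ 2 := by ring
    rw [this, hc]
    ring
  have h1 : (r * t) ^ 2 ≤ (1 - r) ^ 2 := pow_le_pow_left₀ (by positivity) hrt 2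
  have h2 : r ^ 2 * (2 * s) ^ 2 ≤ r * (2 * s) ^ 2 :=
    mul_le_mul_of_nonneg_right (by nlinarith) (sq_nonneg _)
  simp only [mul_zero, zero_mul, mul_one, sub_zero, add_zero, zero_add, zero_sub]
  nlinarith

/-- Away from the real axis by `M y`, the geometric sum at `q` is smaller than at `‖q‖`. -/
theorem re_div_one_sub_sub_le {M x y : ℝ} (hM : 0 < M) (hy : 0 < y) (hMy : π * (M * y) ≤ 1)
    (hx : M * y < |x|) (hx2 : |x| ≤ 1 / 2) {q : ℂ}
    (hq : q = Complex.exp ((-(2 * π * y) : ℝ) + (2 * (π * x) : ℝ) * Complex.I)) :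
    (q / (1 - q)).re - ‖q‖ / (1 - ‖q‖) ≤
      -(1 / (2 * π * y)) * (1 - 1 / √(1 + M ^ 2)) + 2 := by
  have hπ := Real.pi_pos
  set t := 2 * π * y with ht_def
  have ht : 0 < t := by positivity
  have hMt : M * t ≤ 2 := by rw [ht_def]; linarith
  have hnq : ‖q‖ = Real.exp (-t) := by rw [hq, Complex.norm_exp]; simp
  have hr0 : 0 < Real.exp (-t) := Real.exp_pos _
  have hreal : 1 / t - 1 ≤ Real.exp (-t) / (1 - Real.exp (-t)) := by
    have h1 := Real.add_one_le_exp (-t)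
    have h3 : 0 < 1 - Real.exp (-t) := by
      have : Real.exp (-t) < 1 := Real.exp_lt_one_iff.mpr (by linarith)
      linarith
    have h4 : Real.exp (-t) / (1 - Real.exp (-t)) = 1 / (1 - Real.exp (-t)) - 1 := by
      field_simp
      ring
    rw [h4]
    have := one_div_le_one_div_of_le h3 (show 1 - Real.exp (-t) ≤ t by linarith)
    linarith
  set S := √(1 + M ^ 2) with hS_def
  have hS1 : 1 ≤ S := Real.one_le_sqrt.mpr (by nlinarith)
  have hS2 : S ^ 2 = 1 + M ^ 2 := Real.sq_sqrt (by positivity)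
  have hMS : M ≤ S := by nlinarith
  have hsin : M * t * (1 - M * t / 8) ≤ |2 * Real.sin (π * x)| := by
    have habs : |Real.sin (π * x)| = Real.sin (π * |x|) := by
      have hnn : 0 ≤ Real.sin (π * |x|) :=
        Real.sin_nonneg_of_nonneg_of_le_pi (by positivity) (by nlinarith)
      rcases abs_cases x with ⟨h, _⟩ | ⟨h, _⟩
      · rw [h] at hnn ⊢
        exact abs_of_nonneg hnn
      · rw [h, mul_neg, Real.sin_neg] at hnn ⊢
        exact abs_of_nonpos (by linarith)
    rw [abs_mul, habs, abs_of_pos (two_pos)]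
    have hmono : Real.sin (π * (M * y)) ≤ Real.sin (π * |x|) :=
      Real.sin_le_sin_of_le_of_le_pi_div_two
        (by have : 0 < π * (M * y) := by positivity
            linarith) (by nlinarith) (by nlinarith)
    have hcube := Real.sin_gt_sub_cube (x := π * (M * y)) (by positivity)
    have hv : M * t = 2 * (π * (M * y)) := by rw [ht_def]; ring
    have hv0 : 0 < π * (M * y) := by positivity
    rw [hv]
    set v := π * (M * y)
    nlinarith [mul_pos hv0 hv0]
  have hdist : Real.exp (-t) * (t * S * (1 - M * t / 8)) ≤ ‖1 - q‖ := by
    have h := exp_neg_sq_mul_le_norm_one_sub_sq (x := x) ht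
    rw [← hq] at h
    refine le_of_sq_le_sq ?_ (norm_nonneg _)
    refine le_trans ?_ h
    have hd : 0 ≤ 1 - M * t / 8 := by linarith
    have h1 : (M * t * (1 - M * t / 8)) ^ 2 ≤ (2 * Real.sin (π * x)) ^ 2 := by
      rw [← sq_abs (2 * _)]
      exact pow_le_pow_left₀ (by positivity) hsin 2
    have h2 : (t * (1 - M * t / 8)) ^ 2 ≤ t ^ 2 := by
      refine pow_le_pow_left₀ (by positivity) ?_ 2
      nlinarith [mul_pos hM ht]
    have h3 : (Real.exp (-t) * (t * S * (1 - M * t / 8))) ^ 2 = Real.exp (-t) ^ 2 *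
        ((t * (1 - M * t / 8)) ^ 2 + (M * t * (1 - M * t / 8)) ^ 2) := by
      have : (Real.exp (-t) * (t * S * (1 - M * t / 8))) ^ 2 =
        Real.exp (-t) ^ 2 * (t ^ 2 * S ^ 2 * (1 - M * t / 8) ^ 2) := by ring
      rw [this, hS2]
      ring
    rw [h3]
    gcongr
  have hmain : (q / (1 - q)).re ≤ 1 / (t * S) + 1 := by
    have hd : 0 < 1 - M * t / 8 := by linarith
    calc (q / (1 - q)).re ≤ ‖q / (1 - q)‖ := Complex.re_le_norm _
      _ = Real.exp (-t) / ‖1 - q‖ := by rw [norm_div, hnq]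
      _ ≤ Real.exp (-t) / (Real.exp (-t) * (t * S * (1 - M * t / 8))) := by gcongr
      _ = 1 / (t * S * (1 - M * t / 8)) := by field_simp
      _ ≤ 1 / (t * S) + 1 := by
          rw [div_le_iff₀ (by positivity)]
          have e : (1 / (t * S) + 1) * (t * S * (1 - M * t / 8)) =
            (1 + t * S) * (1 - M * t / 8) := by field_simp
          rw [e]
          have hu : 0 ≤ t * (S - M) := mul_nonneg ht.le (by linarith)
          have hw : 0 < M * t := by positivity
          nlinarith [mul_nonneg hu hd.le]
  rw [hnq]
  have e : -(1 / t) * (1 - 1 / S) + 2 = 1 / (t * S) + 1 - (1 / t - 1) := by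
    field_simp
    ring
  rw [e]
  linarith

/-- For `My < |x| ≤ 1/2`, as `y → 0⁺`,
`|(q²;q²)_∞/((q;q)_∞)²| ≪ √(y/2) exp((1/y)(π/8 - (1/π)(1 - 1/√(1+M²))))` where
`τ = x + iy`, `q = e^{2πiτ}`, the implied constant depending only on `M`. -/
theorem eta_quotient_bound (M : ℝ) (hM : 0 < M) :
    ∃ C > (0 : ℝ), ∃ y₀ > (0 : ℝ), ∀ x y : ℝ, 0 < y → y < y₀ →
      M * y < |x| → |x| ≤ 1 / 2 →
      ‖(∏' j : ℕ,
          (1 - Complex.exp (2 * π * Complex.I * ((x : ℂ) + (y : ℂ) * Complex.I))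
            ^ (2 * (j + 1)))) /
          (∏' j : ℕ,
            (1 - Complex.exp (2 * π * Complex.I * ((x : ℂ) + (y : ℂ) * Complex.I))
              ^ (j + 1))) ^ 2‖
        ≤ C * Real.sqrt (y / 2) *
          Real.exp ((1 / y) * (π / 8 - (1 / π) * (1 - 1 / Real.sqrt (1 + M ^ 2)))) := by
  have hπ := Real.pi_pos
  refine ⟨√(4 * π) * Real.exp 4, by positivity, 1 / (π * M), by positivity, ?_⟩
  intro x y hy hy0 hx hx2
  have hMy : π * (M * y) ≤ 1 := by
    rw [lt_div_iff₀ (by positivity)] at hy0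
    linarith
  have harg : 2 * π * Complex.I * ((x : ℂ) + (y : ℂ) * Complex.I) =
      (-(2 * π * y) : ℝ) + (2 * (π * x) : ℝ) * Complex.I := by
    push_cast
    linear_combination (2 * π * y : ℂ) * Complex.I_sq
  rw [harg]
  set q := Complex.exp ((-(2 * π * y) : ℝ) + (2 * (π * x) : ℝ) * Complex.I) with hq
  have ht : 0 < 2 * π * y := by positivity
  have hnq : ‖q‖ = Real.exp (-(2 * π * y)) := by rw [hq, Complex.norm_exp]; simp
  refine (norm_tprod_div_le ht hnq).trans ?_
  have hre := re_div_one_sub_sub_le hM hy hMy hx hx2 hq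
  have hsq : √(4 * π) * √(y / 2) = Real.exp (Real.log (2 * π * y) / 2) := by
    rw [← Real.sqrt_mul (by positivity), ← Real.log_sqrt ht.le, Real.exp_log (by positivity)]
    congr 1
    ring
  have hC : √(4 * π) * Real.exp 4 * √(y / 2) *
      Real.exp ((1 / y) * (π / 8 - (1 / π) * (1 - 1 / √(1 + M ^ 2)))) =
      Real.exp (Real.log (2 * π * y) / 2 + 4 +
        (1 / y) * (π / 8 - (1 / π) * (1 - 1 / √(1 + M ^ 2)))) := by
    rw [Real.exp_add, Real.exp_add, ← hsq]
    ring
  rw [hC]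
  refine Real.exp_le_exp.mpr ?_
  have e1 : π ^ 2 / (4 * (2 * π * y)) = 1 / y * (π / 8) := by
    field_simp
    norm_num
  have e2 : 2 * (-(1 / (2 * π * y)) * (1 - 1 / √(1 + M ^ 2)) + 2) =
      4 - 1 / y * ((1 / π) * (1 - 1 / √(1 + M ^ 2))) := by
    field_simp
    ring
  rw [e1, mul_sub]
  linarith
end
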